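/- For any spray G on an open set U ⊆ ℝⁿ (n ≥ 2), the χ-curvature satisfies χ_k = −(1/2) R_m{}^m{}_{kl} y^l, i.e., χ_k equals minus one half of the trace R_m{}^m{}_{kl} of the four-index Riemann curvature tensor contracted with y^l. -/

import Mathlib

open scoped BigOperators

noncomputable section

/-- Points/vectors in local coordinates on an open subset of `ℝⁿ`. -/
abbrev Vec (n : ℕ) := Fin n → ℝ

variable {n : ℕ}

/-- Partial derivative in the base (`x`) variable, in the `k`-th coordinate direction. -/
noncomputable def pdx (f : Vec n → Vec n → ℝ) (k : Fin n) (x y : Vec n) : ℝ :=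
  fderiv ℝ (fun x' => f x' y) x (Pi.single k 1)

/-- Partial derivative in the fiber (`y`) variable, in the `k`-th coordinate direction;
this is the operation denoted by a subscript `·k`. -/
noncomputable def pdy (f : Vec n → Vec n → ℝ) (k : Fin n) (x y : Vec n) : ℝ :=
  fderiv ℝ (fun y' => f x y') y (Pi.single k 1)

/-- Partial derivative of a function of `x` alone. -/
noncomputable def pd (f : Vec n → ℝ) (k : Fin n) (x : Vec n) : ℝ :=
  fderiv ℝ f x (Pi.single k 1)

/-- `G` is a spray on the open set `U ⊆ ℝⁿ`: the coefficients `Gⁱ(x,y)` are smooth for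
`x ∈ U`, `y ≠ 0`, and positively homogeneous of degree `2` in `y`. -/
def IsSpray (U : Set (Vec n)) (G : Fin n → Vec n → Vec n → ℝ) : Prop :=
  (∀ i, ContDiffOn ℝ (⊤ : ℕ∞) (fun p : Vec n × Vec n => G i p.1 p.2)
      (U ×ˢ {y : Vec n | y ≠ 0})) ∧
  (∀ i (x y : Vec n) (lam : ℝ), 0 < lam → G i x (lam • y) = lam ^ 2 * G i x y)

/-- `N^i_j := ∂G^i/∂y^j`. -/
noncomputable def Nc (G : Fin n → Vec n → Vec n → ℝ) (i j : Fin n) (x y : Vec n) : ℝ :=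
  pdy (G i) j x y

/-- `Γ^i_{jk} := ∂²G^i/∂y^j∂y^k`. -/
noncomputable def Ga (G : Fin n → Vec n → Vec n → ℝ) (i j k : Fin n) (x y : Vec n) : ℝ :=
  pdy (Nc G i j) k x y

/-- The horizontal derivative `δf/δx^k := ∂f/∂x^k − N^m_k ∂f/∂y^m`; for a scalar `f` this is
also the horizontal covariant derivative `f_{|k}`. -/
noncomputable def hd (G : Fin n → Vec n → Vec n → ℝ) (f : Vec n → Vec n → ℝ)
    (k : Fin n) (x y : Vec n) : ℝ :=
  pdx f k x y - ∑ m, Nc G m k x y * pdy f m x y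

/-- The four-index Riemann curvature tensor
`R_j{}^i{}_{kl} := δΓⁱ_{jl}/δx^k − δΓⁱ_{jk}/δx^l + Γⁱ_{ks}Γ^s_{jl} − Γ^s_{jk}Γⁱ_{ls}`. -/
noncomputable def Riem4 (G : Fin n → Vec n → Vec n → ℝ) (j i k l : Fin n)
    (x y : Vec n) : ℝ :=
  hd G (Ga G i j l) k x y - hd G (Ga G i j k) l x y
    + ∑ s, (Ga G i k s x y * Ga G s j l x y - Ga G s j k x y * Ga G i l s x y)

/-- The two-index Riemann curvature `R^i_k := y^j R_j{}^i{}_{kl} y^l`. -/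
noncomputable def Riem2 (G : Fin n → Vec n → Vec n → ℝ) (i k : Fin n)
    (x y : Vec n) : ℝ :=
  ∑ j, ∑ l, y j * Riem4 G j i k l x y * y l

/-- The χ-curvature `χ_k := −(1/6)(2 R^m_{k·m} + R^m_{m·k})`. -/
noncomputable def chi (G : Fin n → Vec n → Vec n → ℝ) (k : Fin n) (x y : Vec n) : ℝ :=
  -(1 / 6) * (2 * ∑ m, pdy (Riem2 G m k) m x y + ∑ m, pdy (Riem2 G m m) k x y)

/-- The scalar `R := (1/(n−1)) R^m_m`. -/
noncomputable def Rsc (G : Fin n → Vec n → Vec n → ℝ) (x y : Vec n) : ℝ :=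
  (1 / ((n : ℝ) - 1)) * ∑ m, Riem2 G m m x y

/-- `Π := ∂G^m/∂y^m`. -/
noncomputable def PiG (G : Fin n → Vec n → Vec n → ℝ) (x y : Vec n) : ℝ :=
  ∑ m, Nc G m m x y

/-- The S-curvature of `(G, dV)` for the volume form `dV = σ(x) dx¹⋯dxⁿ`:
`S := Π − y^m ∂(ln σ)/∂x^m`. -/
noncomputable def Scurv (G : Fin n → Vec n → Vec n → ℝ) (σ : Vec n → ℝ)
    (x y : Vec n) : ℝ :=
  PiG G x y - ∑ m, y m * pd (fun x' => Real.log (σ x')) m x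

/-- The spray `Ĝ` associated with `(G, dV)`: `Ĝⁱ := Gⁱ − (S/(n+1)) yⁱ`. -/
noncomputable def Ghat (G : Fin n → Vec n → Vec n → ℝ) (σ : Vec n → ℝ)
    (i : Fin n) (x y : Vec n) : ℝ :=
  G i x y - (Scurv G σ x y / ((n : ℝ) + 1)) * y i

/-- `σ` is the (positive, smooth) density of a volume form `dV = σ(x) dx¹⋯dxⁿ` on `U`. -/
def IsVolumeForm (U : Set (Vec n)) (σ : Vec n → ℝ) : Prop :=
  ContDiffOn ℝ (⊤ : ℕ∞) σ U ∧ ∀ x ∈ U, 0 < σ x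

/-- `G` is of isotropic curvature on `U`: `Rⁱ_k = R δⁱ_k − (1/2) R_{·k} yⁱ`. -/
def IsIsotropicCurv (U : Set (Vec n)) (G : Fin n → Vec n → Vec n → ℝ) : Prop :=
  ∀ x ∈ U, ∀ y : Vec n, y ≠ 0 → ∀ i k,
    Riem2 G i k x y
      = Rsc G x y * (if i = k then 1 else 0) - (1 / 2) * pdy (Rsc G) k x y * y i

/-- `G` is of scalar curvature on `U`: `Rⁱ_k = R δⁱ_k − τ_k yⁱ` for some functions `τ_k`,
positively homogeneous of degree one in `y`, with `τ_k y^k = R`. -/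
def IsScalarCurv (U : Set (Vec n)) (G : Fin n → Vec n → Vec n → ℝ) : Prop :=
  ∃ τ : Fin n → Vec n → Vec n → ℝ,
    (∀ k (x y : Vec n) (lam : ℝ), 0 < lam → τ k x (lam • y) = lam * τ k x y) ∧
    ∀ x ∈ U, ∀ y : Vec n, y ≠ 0 →
      (∑ k, τ k x y * y k) = Rsc G x y ∧
      ∀ i k, Riem2 G i k x y
        = Rsc G x y * (if i = k then 1 else 0) - τ k x y * y i

/-- `f` is smooth on the part of the tangent bundle over `U` away from the zero section. -/
def SmoothOnSlit (U : Set (Vec n)) (f : Vec n → Vec n → ℝ) : Prop :=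
  ContDiffOn ℝ (⊤ : ℕ∞) (Function.uncurry f) (U ×ˢ {y : Vec n | y ≠ 0})

/-- `f` is positively homogeneous of degree `d` in the fiber variable. -/
def PosHomogeneous (d : ℕ) (f : Vec n → Vec n → ℝ) : Prop :=
  ∀ (x y : Vec n) (lam : ℝ), 0 < lam → f x (lam • y) = lam ^ d * f x y

/-- The curvature `R^i_{kl} := δN^i_l/δx^k − δN^i_k/δx^l` of the nonlinear connection. -/
noncomputable def Riem3 (G : Fin n → Vec n → Vec n → ℝ) (i k l : Fin n)
    (x y : Vec n) : ℝ :=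
  hd G (Nc G i l) k x y - hd G (Nc G i k) l x y

section Calculus

variable {U : Set (Vec n)} {f g : Vec n → Vec n → ℝ} {x y : Vec n}

lemma isOpen_slit (hU : IsOpen U) : IsOpen (U ×ˢ {y : Vec n | y ≠ 0}) :=
  hU.prod isOpen_ne

lemma SmoothOnSlit.contDiffAt (hf : SmoothOnSlit U f) (hU : IsOpen U) (hx : x ∈ U)
    (hy : y ≠ 0) : ContDiffAt ℝ (⊤ : ℕ∞) (Function.uncurry f) (x, y) :=
  ContDiffOn.contDiffAt hf ((isOpen_slit hU).mem_nhds ⟨hx, hy⟩)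

lemma SmoothOnSlit.differentiableAt (hf : SmoothOnSlit U f) (hU : IsOpen U) (hx : x ∈ U)
    (hy : y ≠ 0) : DifferentiableAt ℝ (Function.uncurry f) (x, y) :=
  (hf.contDiffAt hU hx hy).differentiableAt (by simp)

lemma SmoothOnSlit.differentiableAt_fiber (hf : SmoothOnSlit U f) (hU : IsOpen U) (hx : x ∈ U)
    (hy : y ≠ 0) : DifferentiableAt ℝ (fun y' => f x y') y :=
  (hf.differentiableAt hU hx hy).comp (f := fun y' : Vec n => (x, y')) y (by fun_prop)

lemma pdx_eq_fderiv (hf : DifferentiableAt ℝ (Function.uncurry f) (x, y)) (k : Fin n) :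
    pdx f k x y = fderiv ℝ (Function.uncurry f) (x, y) (Pi.single k 1, 0) := by
  have h := hf.hasFDerivAt.comp x (hasFDerivAt_prodMk_left (𝕜 := ℝ) x y)
  have h' : HasFDerivAt (fun x' => f x' y) _ x := h
  simp [pdx, h'.fderiv]

lemma pdy_eq_fderiv (hf : DifferentiableAt ℝ (Function.uncurry f) (x, y)) (k : Fin n) :
    pdy f k x y = fderiv ℝ (Function.uncurry f) (x, y) (0, Pi.single k 1) := by
  have h := hf.hasFDerivAt.comp y (hasFDerivAt_prodMk_right (𝕜 := ℝ) x y)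
  have h' : HasFDerivAt (fun y' => f x y') _ y := h
  simp [pdy, h'.fderiv]

lemma SmoothOnSlit.fderiv_apply (hf : SmoothOnSlit U f) (hU : IsOpen U) (v : Vec n × Vec n) :
    SmoothOnSlit U (fun x y => fderiv ℝ (Function.uncurry f) (x, y) v) :=
  (ContDiffOn.fderiv_of_isOpen hf (isOpen_slit hU) (by simp)).clm_apply contDiffOn_const

lemma SmoothOnSlit.congr (hf : SmoothOnSlit U f)
    (h : ∀ x ∈ U, ∀ y : Vec n, y ≠ 0 → g x y = f x y) : SmoothOnSlit U g :=
  ContDiffOn.congr hf fun p hp => h p.1 hp.1 p.2 hp.2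

protected lemma SmoothOnSlit.pdx (hf : SmoothOnSlit U f) (hU : IsOpen U) (k : Fin n) :
    SmoothOnSlit U (pdx f k) :=
  (hf.fderiv_apply hU (Pi.single k 1, 0)).congr fun _ hx _ hy =>
    pdx_eq_fderiv (hf.differentiableAt hU hx hy) k

protected lemma SmoothOnSlit.pdy (hf : SmoothOnSlit U f) (hU : IsOpen U) (k : Fin n) :
    SmoothOnSlit U (pdy f k) :=
  (hf.fderiv_apply hU (0, Pi.single k 1)).congr fun _ hx _ hy =>
    pdy_eq_fderiv (hf.differentiableAt hU hx hy) k

lemma pdx_congr (hU : IsOpen U) (hx : x ∈ U) (hy : y ≠ 0)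
    (h : ∀ x ∈ U, ∀ y : Vec n, y ≠ 0 → f x y = g x y) (k : Fin n) :
    pdx f k x y = pdx g k x y := by
  have : (fun x' => f x' y) =ᶠ[nhds x] fun x' => g x' y := by
    filter_upwards [hU.mem_nhds hx] with x' hx' using h x' hx' y hy
  simp [pdx, this.fderiv_eq]

lemma pdy_congr (hx : x ∈ U) (hy : y ≠ 0)
    (h : ∀ x ∈ U, ∀ y : Vec n, y ≠ 0 → f x y = g x y) (k : Fin n) :
    pdy f k x y = pdy g k x y := by
  have : (fun y' => f x y') =ᶠ[nhds y] fun y' => g x y' := by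
    filter_upwards [isOpen_ne.mem_nhds hy] with y' hy' using h x hx y' hy'
  simp [pdy, this.fderiv_eq]

lemma hd_congr (G : Fin n → Vec n → Vec n → ℝ) (hU : IsOpen U) (hx : x ∈ U) (hy : y ≠ 0)
    (h : ∀ x ∈ U, ∀ y : Vec n, y ≠ 0 → f x y = g x y) (k : Fin n) :
    hd G f k x y = hd G g k x y := by
  simp only [hd, pdx_congr hU hx hy h, pdy_congr hx hy h]

lemma SmoothOnSlit.fderiv_fderiv_comm (hf : SmoothOnSlit U f) (hU : IsOpen U) (hx : x ∈ U)
    (hy : y ≠ 0) (v w : Vec n × Vec n) :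
    fderiv ℝ (Function.uncurry fun x y => fderiv ℝ (Function.uncurry f) (x, y) v) (x, y) w =
      fderiv ℝ (Function.uncurry fun x y => fderiv ℝ (Function.uncurry f) (x, y) w) (x, y) v := by
  have hc := hf.contDiffAt hU hx hy
  have hd : DifferentiableAt ℝ (fderiv ℝ (Function.uncurry f)) (x, y) :=
    (hc.fderiv_right (m := 1) (by norm_cast)).differentiableAt (by simp)
  have key : ∀ u : Vec n × Vec n,
      fderiv ℝ (Function.uncurry fun x y => fderiv ℝ (Function.uncurry f) (x, y) u) (x, y) =
        (fderiv ℝ (fderiv ℝ (Function.uncurry f)) (x, y)).flip u := fun u => by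
    have := (hd.hasFDerivAt.clm_apply (hasFDerivAt_const u (x, y))).fderiv
    simpa [Function.uncurry_def] using this
  have hsymm := hc.isSymmSndFDerivAt (by simp; norm_cast)
  rw [key, key]
  exact hsymm w v

lemma SmoothOnSlit.pdy_pdx_comm (hf : SmoothOnSlit U f) (hU : IsOpen U) (hx : x ∈ U)
    (hy : y ≠ 0) (j k : Fin n) : pdy (pdx f k) j x y = pdx (pdy f j) k x y := by
  rw [pdy_congr hx hy (fun x hx y hy => pdx_eq_fderiv (hf.differentiableAt hU hx hy) k),
    pdx_congr hU hx hy (fun x hx y hy => pdy_eq_fderiv (hf.differentiableAt hU hx hy) j),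
    pdy_eq_fderiv ((hf.fderiv_apply hU _).differentiableAt hU hx hy),
    pdx_eq_fderiv ((hf.fderiv_apply hU _).differentiableAt hU hx hy)]
  exact hf.fderiv_fderiv_comm hU hx hy _ _

lemma SmoothOnSlit.pdy_pdy_comm (hf : SmoothOnSlit U f) (hU : IsOpen U) (hx : x ∈ U)
    (hy : y ≠ 0) (j k : Fin n) : pdy (pdy f k) j x y = pdy (pdy f j) k x y := by
  rw [pdy_congr hx hy (fun x hx y hy => pdy_eq_fderiv (hf.differentiableAt hU hx hy) k),
    pdy_congr hx hy (fun x hx y hy => pdy_eq_fderiv (hf.differentiableAt hU hx hy) j),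
    pdy_eq_fderiv ((hf.fderiv_apply hU _).differentiableAt hU hx hy),
    pdy_eq_fderiv ((hf.fderiv_apply hU _).differentiableAt hU hx hy)]
  exact hf.fderiv_fderiv_comm hU hx hy _ _

lemma SmoothOnSlit.sub (hf : SmoothOnSlit U f) (hg : SmoothOnSlit U g) :
    SmoothOnSlit U (fun x y => f x y - g x y) :=
  ContDiffOn.sub hf hg

lemma SmoothOnSlit.sum_mul {ι : Type*} {s : Finset ι} {f g : ι → Vec n → Vec n → ℝ}
    (hf : ∀ i, SmoothOnSlit U (f i)) (hg : ∀ i, SmoothOnSlit U (g i)) :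
    SmoothOnSlit U (fun x y => ∑ i ∈ s, f i x y * g i x y) :=
  ContDiffOn.sum fun i _ => ContDiffOn.mul (hf i) (hg i)

lemma pdy_sub (hf : DifferentiableAt ℝ (fun y' => f x y') y)
    (hg : DifferentiableAt ℝ (fun y' => g x y') y) (j : Fin n) :
    pdy (fun x y => f x y - g x y) j x y = pdy f j x y - pdy g j x y := by
  simp [pdy, fderiv_fun_sub hf hg]

lemma pdy_sum_mul {ι : Type*} {s : Finset ι} {f g : ι → Vec n → Vec n → ℝ}
    (hf : ∀ i, DifferentiableAt ℝ (fun y' => f i x y') y)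
    (hg : ∀ i, DifferentiableAt ℝ (fun y' => g i x y') y) (j : Fin n) :
    pdy (fun x y => ∑ i ∈ s, f i x y * g i x y) j x y =
      ∑ i ∈ s, (f i x y * pdy (g i) j x y + pdy (f i) j x y * g i x y) := by
  have h : HasFDerivAt (fun y' => ∑ i ∈ s, f i x y' * g i x y') _ y :=
    HasFDerivAt.fun_sum fun i _ => (hf i).hasFDerivAt.mul (hg i).hasFDerivAt
  simp [pdy, h.fderiv, mul_comm]

protected lemma PosHomogeneous.pdx {d : ℕ} (hf : PosHomogeneous d f) (k : Fin n) :
    PosHomogeneous d (pdx f k) := fun x y lam hlam => by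
  have : (fun x' => f x' (lam • y)) = lam ^ d • fun x' => f x' y := by
    ext x'; simp [hf x' y lam hlam]
  simp [_root_.pdx, this, fderiv_const_smul_field]

protected lemma PosHomogeneous.pdy {d : ℕ} (hf : PosHomogeneous (d + 1) f) (k : Fin n) :
    PosHomogeneous d (pdy f k) := fun x y lam hlam => by
  have h1 : (fun y' => f x (lam • y')) = lam ^ (d + 1) • fun y' => f x y' := by
    ext y'; simp [hf x y' lam hlam]
  have h2 := congrArg (fun F => fderiv ℝ F y (Pi.single k 1)) h1
  simp only [fderiv_const_smul_field, fderiv_comp_smul (f := fun y' => f x y') lam] at h2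
  simp only [_root_.smul_apply, smul_eq_mul, Pi.smul_apply] at h2
  have h3 : lam * _root_.pdy f k x (lam • y) = lam * (lam ^ d * _root_.pdy f k x y) := by
    rw [_root_.pdy, _root_.pdy, h2]; ring
  exact mul_left_cancel₀ hlam.ne' h3

/-- Euler's relation for positively homogeneous functions of degree one. -/
lemma PosHomogeneous.euler (hf : PosHomogeneous 1 f)
    (hd : DifferentiableAt ℝ (fun y' => f x y') y) : ∑ j, y j * pdy f j x y = f x y := by
  have hlin : ∑ j, y j * pdy f j x y = fderiv ℝ (fun y' => f x y') y y := by
    simp only [pdy]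
    generalize fderiv ℝ (fun y' => f x y') y = L
    conv_rhs => rw [pi_eq_sum_univ' y]
    simp
  have hline : HasDerivAt (fun t : ℝ => t • y) y 1 := by
    simpa using (hasDerivAt_id (1 : ℝ)).smul_const y
  have h1 : HasDerivAt (fun t : ℝ => f x (t • y)) (fderiv ℝ (fun y' => f x y') y y) 1 := by
    refine HasFDerivAt.comp_hasDerivAt (l := fun y' => f x y') 1 ?_ hline
    simpa using hd.hasFDerivAt
  have h2 : HasDerivAt (fun t : ℝ => f x (t • y)) (f x y) 1 := by
    have h : HasDerivAt (fun t : ℝ => t * f x y) (f x y) 1 := by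
      simpa using (hasDerivAt_id (1 : ℝ)).mul_const (f x y)
    refine h.congr_of_eventuallyEq ?_
    filter_upwards [lt_mem_nhds (zero_lt_one' ℝ)] with t ht
    simp [hf x y t ht]
  rw [hlin, h1.unique h2]

end Calculus

section Spray

variable {U : Set (Vec n)} {G : Fin n → Vec n → Vec n → ℝ} {f : Vec n → Vec n → ℝ} {x y : Vec n}

lemma IsSpray.smooth_Nc (hG : IsSpray U G) (hU : IsOpen U) (i j : Fin n) :
    SmoothOnSlit U (Nc G i j) :=
  SmoothOnSlit.pdy (hG.1 i) hU j

lemma IsSpray.smooth_hd (hG : IsSpray U G) (hU : IsOpen U) (hf : SmoothOnSlit U f) (k : Fin n) :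
    SmoothOnSlit U (hd G f k) :=
  (hf.pdx hU k).sub (.sum_mul (fun m => hG.smooth_Nc hU m k) fun m => hf.pdy hU m)

lemma IsSpray.smooth_Riem3 (hG : IsSpray U G) (hU : IsOpen U) (i k l : Fin n) :
    SmoothOnSlit U (Riem3 G i k l) :=
  (hG.smooth_hd hU (hG.smooth_Nc hU i l) k).sub (hG.smooth_hd hU (hG.smooth_Nc hU i k) l)

lemma IsSpray.posHomogeneous_Nc (hG : IsSpray U G) (i j : Fin n) :
    PosHomogeneous 1 (Nc G i j) :=
  PosHomogeneous.pdy (hG.2 i) j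

lemma IsSpray.posHomogeneous_hd (hG : IsSpray U G) (hf : PosHomogeneous 1 f) (k : Fin n) :
    PosHomogeneous 1 (hd G f k) := fun x y lam hlam => by
  have h0 : ∀ m, pdy f m x (lam • y) = pdy f m x y := fun m => by
    simpa using hf.pdy (d := 0) m x y lam hlam
  simp only [hd, hf.pdx k x y lam hlam, hG.posHomogeneous_Nc _ _ x y lam hlam, h0, mul_sub,
    Finset.mul_sum, mul_assoc]

lemma IsSpray.posHomogeneous_Riem3 (hG : IsSpray U G) (i k l : Fin n) :
    PosHomogeneous 1 (Riem3 G i k l) := fun x y lam hlam => by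
  simp only [Riem3, hG.posHomogeneous_hd (hG.posHomogeneous_Nc _ _) _ x y lam hlam, mul_sub]

lemma IsSpray.Ga_comm (hG : IsSpray U G) (hU : IsOpen U) (hx : x ∈ U) (hy : y ≠ 0)
    (i j k : Fin n) : Ga G i j k x y = Ga G i k j x y :=
  SmoothOnSlit.pdy_pdy_comm (hG.1 i) hU hx hy k j

lemma IsSpray.pdy_hd (hG : IsSpray U G) (hU : IsOpen U) (hf : SmoothOnSlit U f) (hx : x ∈ U)
    (hy : y ≠ 0) (j k : Fin n) :
    pdy (hd G f k) j x y = hd G (pdy f j) k x y - ∑ m, Ga G m k j x y * pdy f m x y := by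
  have hN := fun m => hG.smooth_Nc hU m k
  have hfm := fun m => hf.pdy hU m
  have hsub := pdy_sub (g := fun x y => ∑ m, Nc G m k x y * pdy f m x y)
    ((hf.pdx hU k).differentiableAt_fiber hU hx hy)
    ((SmoothOnSlit.sum_mul (s := Finset.univ) hN hfm).differentiableAt_fiber hU hx hy) j
  have hsum := pdy_sum_mul (s := Finset.univ)
    (fun m => (hN m).differentiableAt_fiber hU hx hy)
    (fun m => (hfm m).differentiableAt_fiber hU hx hy) j
  unfold hd
  rw [hsub, hsum, hf.pdy_pdx_comm hU hx hy, Finset.sum_add_distrib]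
  simp only [hf.pdy_pdy_comm hU hx hy j, Ga]
  ring

/-- The four-index curvature is the fiber derivative of the curvature of `N`. -/
lemma IsSpray.pdy_Riem3 (hG : IsSpray U G) (hU : IsOpen U) (hx : x ∈ U) (hy : y ≠ 0)
    (i j k l : Fin n) : pdy (Riem3 G i k l) j x y = Riem4 G j i k l x y := by
  have hN := fun l => hG.smooth_Nc hU i l
  have hsub := pdy_sub ((hG.smooth_hd hU (hN l) k).differentiableAt_fiber hU hx hy)
    ((hG.smooth_hd hU (hN k) l).differentiableAt_fiber hU hx hy) j
  have hcomm := fun l => hd_congr G (f := pdy (Nc G i l) j) (g := Ga G i j l) hU hx hy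
    fun x hx y hy => hG.Ga_comm hU hx hy i l j
  unfold Riem3 Riem4
  rw [hsub, hG.pdy_hd hU (hN l) hx hy, hG.pdy_hd hU (hN k) hx hy, hcomm, hcomm,
    Finset.sum_sub_distrib]
  have h1 : ∑ m, Ga G m k j x y * pdy (Nc G i l) m x y =
      ∑ s, Ga G s j k x y * Ga G i l s x y :=
    Finset.sum_congr rfl fun m _ => by rw [hG.Ga_comm hU hx hy m k j]; rfl
  have h2 : ∑ m, Ga G m l j x y * pdy (Nc G i k) m x y =
      ∑ s, Ga G i k s x y * Ga G s j l x y :=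
    Finset.sum_congr rfl fun m _ => by rw [hG.Ga_comm hU hx hy m l j, mul_comm]; rfl
  rw [h1, h2]
  ring

lemma IsSpray.sum_mul_Riem4 (hG : IsSpray U G) (hU : IsOpen U) (hx : x ∈ U) (hy : y ≠ 0)
    (i k l : Fin n) : ∑ j, y j * Riem4 G j i k l x y = Riem3 G i k l x y := by
  simp only [← hG.pdy_Riem3 hU hx hy]
  exact (hG.posHomogeneous_Riem3 i k l).euler
    ((hG.smooth_Riem3 hU i k l).differentiableAt_fiber hU hx hy)

lemma IsSpray.Riem2_eq (hG : IsSpray U G) (hU : IsOpen U) (hx : x ∈ U) (hy : y ≠ 0)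
    (i k : Fin n) : Riem2 G i k x y = ∑ l, Riem3 G i k l x y * y l := by
  rw [Riem2, Finset.sum_comm]
  simp only [← Finset.sum_mul, hG.sum_mul_Riem4 hU hx hy]

lemma IsSpray.pdy_Riem2 (hG : IsSpray U G) (hU : IsOpen U) (hx : x ∈ U) (hy : y ≠ 0)
    (i j k : Fin n) :
    pdy (Riem2 G i k) j x y = Riem3 G i k j x y + ∑ l, Riem4 G j i k l x y * y l := by
  have hcoord : ∀ l, pdy (fun _ y => y l) j x y = if l = j then 1 else 0 := fun l => by
    simp [pdy, (hasFDerivAt_apply (𝕜 := ℝ) l y).fderiv, Pi.single_apply]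
  rw [pdy_congr hx hy (fun x hx y hy => hG.Riem2_eq hU hx hy i k),
    pdy_sum_mul (g := fun l _ y => y l)
      (fun l => (hG.smooth_Riem3 hU i k l).differentiableAt_fiber hU hx hy)
      (fun l => (differentiableAt_apply l y))]
  simp [hcoord, Finset.sum_add_distrib, hG.pdy_Riem3 hU hx hy]

lemma Riem3_swap (G : Fin n → Vec n → Vec n → ℝ) (i k l : Fin n) (x y : Vec n) :
    Riem3 G i k l x y = -Riem3 G i l k x y := by
  simp [Riem3]

/-- The first Bianchi identity. -/
lemma IsSpray.bianchi (hG : IsSpray U G) (hU : IsOpen U) (hx : x ∈ U) (hy : y ≠ 0)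
    (i j k l : Fin n) :
    Riem4 G j i k l x y + Riem4 G k i l j x y + Riem4 G l i j k x y = 0 := by
  have hcomm := fun a b c => hd_congr G (f := Ga G i a b) (g := Ga G i b a) hU hx hy
    (fun x hx y hy => hG.Ga_comm hU hx hy i a b) c
  have hmul : ∀ a b c, ∑ s, Ga G s a b x y * Ga G i c s x y =
      ∑ s, Ga G i c s x y * Ga G s b a x y := fun a b c =>
    Finset.sum_congr rfl fun s _ => by rw [hG.Ga_comm hU hx hy s a b, mul_comm]
  simp only [Riem4, Finset.sum_sub_distrib, hmul]
  rw [hcomm j l k, hcomm j k l, hcomm k l j]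
  have hsymm : ∀ a b c, ∑ s, Ga G i c s x y * Ga G s a b x y =
      ∑ s, Ga G i c s x y * Ga G s b a x y := fun a b c =>
    Finset.sum_congr rfl fun s _ => by rw [hG.Ga_comm hU hx hy s a b]
  rw [hsymm j l k, hsymm k j l, hsymm l k j]
  ring

lemma Riem4_swap (G : Fin n → Vec n → Vec n → ℝ) (j i k l : Fin n) (x y : Vec n) :
    Riem4 G j i k l x y = -Riem4 G j i l k x y := by
  simp only [Riem4, Finset.sum_sub_distrib]
  simp only [mul_comm (Ga G i _ _ x y)]
  ring

end Spray

/-- `χ_k = −(1/2) R_m{}^m{}_{kl} y^l`. -/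
theorem chi_eq_trace_Riem4
    {n : ℕ} (hn : 2 ≤ n) (U : Set (Vec n)) (hU : IsOpen U)
    (G : Fin n → Vec n → Vec n → ℝ) (hG : IsSpray U G) :
    ∀ x ∈ U, ∀ y : Vec n, y ≠ 0 → ∀ k,
      chi G k x y = -(1 / 2) * ∑ m, ∑ l, Riem4 G m m k l x y * y l := by
  intro x hx y hy k
  have hcontr : ∀ m, ∑ l, Riem4 G k m m l x y * y l =
      ∑ l, Riem4 G m m k l x y * y l - Riem3 G m k m x y := fun m => by
    rw [← hG.sum_mul_Riem4 hU hx hy m k m, ← Finset.sum_sub_distrib]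
    refine Finset.sum_congr rfl fun l _ => ?_
    linear_combination y l * hG.bianchi hU hx hy m k m l - y l * Riem4_swap G m m k l x y
  simp only [chi, hG.pdy_Riem2 hU hx hy, hcontr, Finset.sum_add_distrib, Finset.sum_sub_distrib]
  have hswap : ∑ m, Riem3 G m m k x y = -∑ m, Riem3 G m k m x y := by
    rw [← Finset.sum_neg_distrib]
    exact Finset.sum_congr rfl fun m _ => Riem3_swap G m m k x y
  rw [hswap]
  ring
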